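/- Let g : [0,∞) → ℝ be continuously differentiable and nondecreasing and let Φ : ℝ → ℝ be continuously differentiable, strictly positive and nondecreasing. Then for every ℓ ≥ 0, lim_{ε→0⁺} ∏_{n=1}^{⌊ℓ/ε⌋} Φ(g(nε−ε)−ε) / Φ(g(nε)) = exp( −∫_{0}^{ℓ} (g′(a)+1) · Φ′(g(a))/Φ(g(a)) da ), where ⌊·⌋ denotes the floor function. -/

import Mathlib

open Filter

/-- One step of the discretization: the increment from `g x - s` to `g (x + s)` of a `C¹` function
`F` agrees with the increment of an antiderivative `J` of `(g' + 1) * F' ∘ g` up to `δ * s`,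
uniformly for `x` in a compact interval. -/
lemma exists_forall_abs_step_le {g F J : ℝ → ℝ} (hg : ContDiff ℝ 1 g) (hF : ContDiff ℝ 1 F)
    (hJ : ∀ a, HasDerivAt J ((deriv g a + 1) * deriv F (g a)) a) (ℓ : ℝ) {δ : ℝ} (hδ : 0 < δ) :
    ∃ r > 0, ∀ s, 0 < s → s < r → ∀ x ∈ Set.Icc 0 ℓ,
      |F (g x - s) - F (g (x + s)) + (J (x + s) - J x)| ≤ δ * s := by
  have hgc := hg.continuous
  have hfc : Continuous (deriv F) := hF.continuous_deriv_one
  have hev : ∀ᶠ s in nhds (0 : ℝ), ∀ x ∈ Set.Icc 0 ℓ,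
      |deriv F (g (x + s)) - deriv F (g x - s)| < δ := by
    refine isCompact_Icc.eventually_forall_of_forall_eventually fun x _ => ?_
    have hc : Continuous fun z : ℝ × ℝ =>
        |deriv F (g (z.2 + z.1)) - deriv F (g z.2 - z.1)| := by fun_prop
    exact hc.continuousAt.eventually_lt continuousAt_const (by simpa using hδ)
  obtain ⟨r, hr, hball⟩ := Metric.eventually_nhds_iff.1 hev
  refine ⟨r, hr, fun s hs hsr x hx => ?_⟩
  have hder : ∀ t, HasDerivAt (fun t => F (g x - t) - F (g (x + t)) + (J (x + t) - J x))
      (deriv F (g (x + t)) - deriv F (g x - t)) t := by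
    intro t
    have hgd : HasDerivAt (fun t => g (x + t)) (deriv g (x + t)) t :=
      ((hg.differentiable one_ne_zero _).hasDerivAt).comp_const_add x t
    have h1 : HasDerivAt (fun t => F (g x - t)) (-deriv F (g x - t)) t :=
      ((hF.differentiable one_ne_zero _).hasDerivAt).comp_const_sub (g x) t
    have h2 : HasDerivAt (fun t => F (g (x + t))) (deriv F (g (x + t)) * deriv g (x + t)) t :=
      HasDerivAt.comp t (hF.differentiable one_ne_zero _).hasDerivAt hgd
    have h3 := ((hJ (x + t)).comp_const_add x t).sub_const (J x)
    exact ((h1.sub h2).add h3).congr_deriv (by ring)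
  have := norm_image_sub_le_of_norm_deriv_le_segment' (a := 0) (b := s) (C := δ)
    (fun t _ => (hder t).hasDerivWithinAt)
    (fun t ht => (hball (by
      rw [Real.dist_eq, sub_zero, abs_of_nonneg ht.1]; exact ht.2.trans hsr) x hx).le)
    s (Set.right_mem_Icc.2 hs.le)
  simpa using this

lemma tendsto_floor_div_mul_self {ℓ : ℝ} (hℓ : 0 ≤ ℓ) :
    Tendsto (fun ε : ℝ => (⌊ℓ / ε⌋₊ : ℝ) * ε) (nhdsWithin 0 (Set.Ioi 0)) (nhds ℓ) := by
  have hlow : Tendsto (fun ε : ℝ => ℓ - ε) (nhdsWithin 0 (Set.Ioi 0)) (nhds ℓ) := by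
    have : Continuous fun ε : ℝ => ℓ - ε := by fun_prop
    simpa using (this.tendsto 0).mono_left nhdsWithin_le_nhds
  refine tendsto_of_tendsto_of_tendsto_of_le_of_le' hlow tendsto_const_nhds ?_ ?_
  · filter_upwards [self_mem_nhdsWithin] with ε (hε : 0 < ε)
    have := (div_lt_iff₀ hε).1 (Nat.lt_floor_add_one (ℓ / ε))
    linarith
  · filter_upwards [self_mem_nhdsWithin] with ε (hε : 0 < ε)
    exact (le_div_iff₀ hε).1 (Nat.floor_le (div_nonneg hℓ hε.le))

/-- For `g` and `F` of class `C¹`, the sums of the increments of `F` from `g (nε)` to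
`g ((n - 1)ε) - ε` converge to minus the increment of an antiderivative of `(g' + 1) * F' ∘ g`. -/
lemma tendsto_sum_elastic_increments {g F J : ℝ → ℝ} (hg : ContDiff ℝ 1 g) (hF : ContDiff ℝ 1 F)
    (hJ : ∀ a, HasDerivAt J ((deriv g a + 1) * deriv F (g a)) a) {ℓ : ℝ} (hℓ : 0 ≤ ℓ) :
    Tendsto (fun ε : ℝ => ∑ n ∈ Finset.Icc 1 ⌊ℓ / ε⌋₊,
        (F (g ((n : ℝ) * ε - ε) - ε) - F (g ((n : ℝ) * ε))))
      (nhdsWithin 0 (Set.Ioi 0)) (nhds (-(J ℓ - J 0))) := by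
  have hJc : Tendsto (fun ε : ℝ => -(J ((⌊ℓ / ε⌋₊ : ℝ) * ε) - J 0)) (nhdsWithin 0 (Set.Ioi 0))
      (nhds (-(J ℓ - J 0))) :=
    (((hJ ℓ).continuousAt.tendsto.comp (tendsto_floor_div_mul_self hℓ)).sub_const _).neg
  have herr : Tendsto (fun ε : ℝ => ∑ n ∈ Finset.Icc 1 ⌊ℓ / ε⌋₊,
        (F (g ((n : ℝ) * ε - ε) - ε) - F (g ((n : ℝ) * ε))) -
          -(J ((⌊ℓ / ε⌋₊ : ℝ) * ε) - J 0)) (nhdsWithin 0 (Set.Ioi 0)) (nhds 0) := by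
    rw [Metric.tendsto_nhds]
    intro η hη
    obtain ⟨r, hr, hstep⟩ := exists_forall_abs_step_le hg hF hJ ℓ
      (δ := η / (ℓ + 1)) (by positivity)
    filter_upwards [Ioo_mem_nhdsGT hr] with ε hε
    set N := ⌊ℓ / ε⌋₊
    have hN : (N : ℝ) * ε ≤ ℓ :=
      (le_div_iff₀ hε.1).1 (Nat.floor_le (div_nonneg hℓ hε.1.le))
    have htel : J ((N : ℝ) * ε) - J 0 =
        ∑ k ∈ Finset.range N, (J ((k : ℝ) * ε + ε) - J ((k : ℝ) * ε)) := by
      have := Finset.sum_range_sub (fun k : ℕ => J ((k : ℝ) * ε)) N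
      simp only [Nat.cast_add, Nat.cast_one, Nat.cast_zero, zero_mul, add_mul, one_mul] at this
      exact this.symm
    have hshift : ∑ n ∈ Finset.Icc 1 N, (F (g ((n : ℝ) * ε - ε) - ε) - F (g ((n : ℝ) * ε))) =
        ∑ k ∈ Finset.range N, (F (g ((k : ℝ) * ε) - ε) - F (g ((k : ℝ) * ε + ε))) := by
      rw [Finset.range_eq_Ico, ← Finset.Ico_succ_right_eq_Icc,
        Finset.sum_Ico_eq_sum_range, Finset.range_eq_Ico]
      refine Finset.sum_congr (by simp) fun k _ => ?_
      have : ((1 + k : ℕ) : ℝ) * ε = (k : ℝ) * ε + ε := by push_cast; ring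
      rw [this, add_sub_cancel_right]
    rw [Real.dist_eq, sub_zero, hshift, htel, sub_neg_eq_add, ← Finset.sum_add_distrib]
    calc |∑ k ∈ Finset.range N, (F (g ((k : ℝ) * ε) - ε) - F (g ((k : ℝ) * ε + ε)) +
            (J ((k : ℝ) * ε + ε) - J ((k : ℝ) * ε)))|
        ≤ ∑ k ∈ Finset.range N, η / (ℓ + 1) * ε := by
          refine (Finset.abs_sum_le_sum_abs _ _).trans (Finset.sum_le_sum fun k hk => ?_)
          refine hstep ε hε.1 hε.2 _ ⟨mul_nonneg k.cast_nonneg hε.1.le, le_trans ?_ hN⟩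
          have : (k : ℝ) ≤ N := by exact_mod_cast (Finset.mem_range.1 hk).le
          exact mul_le_mul_of_nonneg_right this hε.1.le
      _ = η / (ℓ + 1) * (N * ε) := by
          rw [Finset.sum_const, Finset.card_range, nsmul_eq_mul]; ring
      _ ≤ η / (ℓ + 1) * ℓ := by gcongr
      _ < η := by
          rw [div_mul_eq_mul_div, div_lt_iff₀ (by positivity)]
          linarith
  simpa using herr.add hJc

/-- For `g` C¹ nondecreasing on `[0,∞)` and `Φ` C¹, strictly positive and
nondecreasing, for every `ℓ ≥ 0`:
`lim_{ε→0⁺} ∏_{n=1}^{⌊ℓ/ε⌋} Φ(g(nε−ε)−ε)/Φ(g(nε))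
  = exp( −∫_0^ℓ (g′(a)+1) · Φ′(g(a))/Φ(g(a)) da )`. -/
theorem stmt4 (g Φ : ℝ → ℝ)
    (hg : ContDiff ℝ 1 g) (hg_mono : MonotoneOn g (Set.Ici (0 : ℝ)))
    (hΦ : ContDiff ℝ 1 Φ) (hΦ_pos : ∀ x, 0 < Φ x) (hΦ_mono : Monotone Φ)
    (ℓ : ℝ) (hℓ : 0 ≤ ℓ) :
    Tendsto
      (fun ε : ℝ =>
        ∏ n ∈ Finset.Icc 1 ⌊ℓ / ε⌋₊, Φ (g ((n : ℝ) * ε - ε) - ε) / Φ (g ((n : ℝ) * ε)))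
      (nhdsWithin 0 (Set.Ioi 0))
      (nhds (Real.exp
        (-∫ a in (0 : ℝ)..ℓ, (deriv g a + 1) * (deriv Φ (g a) / Φ (g a))))) := by
  have hF : ContDiff ℝ 1 fun x => Real.log (Φ x) := hΦ.log fun x => (hΦ_pos x).ne'
  have hFd : ∀ x, deriv (fun x => Real.log (Φ x)) x = deriv Φ x / Φ x := fun x =>
    deriv.log (hΦ.differentiable one_ne_zero x) (hΦ_pos x).ne'
  have hK : Continuous fun a => (deriv g a + 1) * (deriv Φ (g a) / Φ (g a)) :=
    (hg.continuous_deriv_one.add continuous_const).mul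
      ((hΦ.continuous_deriv_one.comp hg.continuous).div (hΦ.continuous.comp hg.continuous)
        fun _ => (hΦ_pos _).ne')
  have hsum := tendsto_sum_elastic_increments hg hF
    (J := fun x => ∫ a in (0 : ℝ)..x, (deriv g a + 1) * (deriv Φ (g a) / Φ (g a)))
    (fun a => by rw [hFd]; exact (hK.integral_hasStrictDerivAt 0 a).hasDerivAt) hℓ
  rw [intervalIntegral.integral_same, sub_zero] at hsum
  refine ((Real.continuous_exp.tendsto _).comp hsum).congr fun ε => ?_
  simp only [Function.comp_apply, Real.exp_sum, Real.exp_sub, Real.exp_log (hΦ_pos _)]
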